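/- Let F be a field with char F ≠ 2, n ≥ 1, and let (V, V') be a pair of isotropic subspaces of F^{2n+1} with dim V = dim V' = ℓ which is nondegenerate, i.e. V ∩ (V')^⊥ = {0} and V' ∩ V^⊥ = {0}. Then there exists g ∈ G = O_{2n+1}(F) such that gV = span(e_1, …, e_ℓ) and gV' = span(e_{2n+2−ℓ}, …, e_{2n+1}). -/

import Mathlib

open Module

/-- The symmetric bilinear form on `F^N` given by `(e_i, e_j) = δ_{i, N+1-j}`
(in 1-indexed notation), i.e. `(u, v) = ∑ i, u i * v (rev i)`. -/
def bform (F : Type*) [Field F] (N : ℕ) (u v : Fin N → F) : F :=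
  ∑ i, u i * v i.rev

/-- `g` belongs to the split orthogonal group `O_N(F)`. -/
def IsOrthMap (F : Type*) [Field F] (N : ℕ)
    (g : (Fin N → F) ≃ₗ[F] (Fin N → F)) : Prop :=
  ∀ u v, bform F N (g u) (g v) = bform F N u v

/-- A subspace `V` is isotropic if `(V, V) = {0}`. -/
def IsIsotropic (F : Type*) [Field F] (N : ℕ) (V : Submodule F (Fin N → F)) : Prop :=
  ∀ u ∈ V, ∀ v ∈ V, bform F N u v = 0

/-- The orthogonal space `S^⊥ = {v : (v, S) = {0}}` of a subspace `S`. -/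
def orthCompl (F : Type*) [Field F] (N : ℕ) (S : Submodule F (Fin N → F)) :
    Submodule F (Fin N → F) where
  carrier := {v | ∀ s ∈ S, bform F N v s = 0}
  zero_mem' := by
    intro s hs
    simp [bform]
  add_mem' := by
    intro a b ha hb s hs
    have h1 := ha s hs
    have h2 := hb s hs
    simp only [bform, Pi.add_apply, add_mul, Finset.sum_add_distrib] at h1 h2 ⊢
    rw [h1, h2, add_zero]
  smul_mem' := by
    intro t v hv s hs
    have h1 := hv s hs
    simp only [bform, Pi.smul_apply, smul_eq_mul, mul_assoc, ← Finset.mul_sum] at h1 ⊢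
    rw [h1, mul_zero]

/-- The reflection in a non-isotropic vector `x` is an isometry. -/
theorem exists_isometry_reflection {F E : Type*} [Field F] [AddCommGroup E] [Module F E]
    (B : LinearMap.BilinForm F E) (hB : ∀ x y, B x y = B y x) {x : E} (hx : B x x ≠ 0) :
    ∃ g : E ≃ₗ[F] E, (∀ u v, B (g u) (g v) = B u v) ∧
      ∀ u, g u = u - (2 * B x u / B x x) • x := by
  have h : ((2 / B x x) • B x) x = 2 := by simp [hx]
  have key : ∀ u, Module.reflection h u = u - (2 * B x u / B x x) • x := by
    intro u
    rw [Module.reflection_apply, LinearMap.smul_apply, smul_eq_mul, div_mul_eq_mul_div]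
  refine ⟨Module.reflection h, fun u v => ?_, key⟩
  rw [key, key]
  simp only [map_sub, map_smul, LinearMap.sub_apply, LinearMap.smul_apply, smul_eq_mul]
  rw [hB u x]
  field_simp
  ring

/-- Two vectors with the same nonzero square are related by an isometry fixing every vector
orthogonal to both. -/
theorem exists_isometry_apply_eq {F E : Type*} [Field F] [AddCommGroup E] [Module F E]
    (h2 : (2 : F) ≠ 0) (B : LinearMap.BilinForm F E) (hB : ∀ x y, B x y = B y x) {x y : E}
    (hx : B x x ≠ 0) (hxy : B x x = B y y) :
    ∃ g : E ≃ₗ[F] E, (∀ u v, B (g u) (g v) = B u v) ∧ g x = y ∧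
      ∀ z, B x z = 0 → B y z = 0 → g z = z := by
  by_cases h : B (x - y) (x - y) = 0
  · have h' : B (x + y) (x + y) ≠ 0 := by
      have h4 : B (x + y) (x + y) = 2 * 2 * B x x := by
        simp only [map_sub, map_add, LinearMap.sub_apply, LinearMap.add_apply] at h ⊢
        linear_combination (-1 : F) * h - 2 * hxy
      rw [h4]
      exact mul_ne_zero (mul_ne_zero h2 h2) hx
    obtain ⟨g, hg, hgu⟩ := exists_isometry_reflection B hB h'
    obtain ⟨k, hk, hku⟩ := exists_isometry_reflection B hB (hxy ▸ hx : B y y ≠ 0)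
    refine ⟨g.trans k, fun u v => by simp [hg, hk], ?_, fun z hxz hyz => ?_⟩
    · have h1 : 2 * B (x + y) x / B (x + y) (x + y) = 1 := by
        rw [div_eq_one_iff_eq h']
        simp only [map_add, LinearMap.add_apply]
        rw [hB y x]
        linear_combination hxy
      have h3 : 2 * B y (-y) / B y y = -2 := by
        rw [map_neg]
        field_simp [(hxy ▸ hx : B y y ≠ 0)]
      rw [LinearEquiv.trans_apply, hgu, h1, one_smul, sub_add_cancel_left, hku, h3]
      module
    · simp [hgu, hku, hxz, hyz]
  · obtain ⟨g, hg, hgu⟩ := exists_isometry_reflection B hB h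
    refine ⟨g, hg, ?_, fun z hxz hyz => by simp [hgu, hxz, hyz]⟩
    have h1 : 2 * B (x - y) x / B (x - y) (x - y) = 1 := by
      rw [div_eq_one_iff_eq h]
      simp only [map_sub, LinearMap.sub_apply]
      rw [hB y x]
      linear_combination hxy
    rw [hgu, h1, one_smul, sub_sub_cancel]

/-- Witt's theorem for orthogonal families of non-isotropic vectors. -/
theorem exists_isometry_of_orthogonal {F E ι : Type*} [Field F] [AddCommGroup E] [Module F E]
    (h2 : (2 : F) ≠ 0) (B : LinearMap.BilinForm F E) (hB : ∀ x y, B x y = B y x) (a b : ι → E)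
    (ha : ∀ i j, i ≠ j → B (a i) (a j) = 0) (hb : ∀ i j, i ≠ j → B (b i) (b j) = 0)
    (hab : ∀ i, B (a i) (a i) = B (b i) (b i)) (ha0 : ∀ i, B (a i) (a i) ≠ 0) (s : Finset ι) :
    ∃ g : E ≃ₗ[F] E, (∀ u v, B (g u) (g v) = B u v) ∧ ∀ i ∈ s, g (a i) = b i := by
  classical
  induction s using Finset.induction_on with
  | empty => exact ⟨LinearEquiv.refl F E, by simp, by simp⟩
  | insert i s his ih =>
    obtain ⟨g, hg, hgs⟩ := ih
    obtain ⟨k, hk, hki, hkz⟩ := exists_isometry_apply_eq h2 B hB (x := g (a i)) (y := b i)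
      (by rw [hg]; exact ha0 i) (by rw [hg]; exact hab i)
    refine ⟨g.trans k, fun u v => by simp [hg, hk], fun j hj => ?_⟩
    rcases Finset.mem_insert.1 hj with rfl | hj
    · exact hki
    · have hij : i ≠ j := fun h => his (h ▸ hj)
      rw [LinearEquiv.trans_apply, hgs j hj]
      refine hkz _ ?_ (hb i j hij)
      rw [← hgs j hj, hg, ha i j hij]

/-- Any two finite families of mutually orthogonal hyperbolic pairs are related by an isometry. -/
theorem exists_isometry_of_hyperbolic {F E ι : Type*} [Field F] [AddCommGroup E] [Module F E]
    [Finite ι] [DecidableEq ι] (h2 : (2 : F) ≠ 0) (B : LinearMap.BilinForm F E)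
    (hB : ∀ x y, B x y = B y x) (v v' w w' : ι → E)
    (hv : ∀ i j, B (v i) (v j) = 0) (hv' : ∀ i j, B (v' i) (v' j) = 0)
    (hvv' : ∀ i j, B (v i) (v' j) = if i = j then 1 else 0)
    (hw : ∀ i j, B (w i) (w j) = 0) (hw' : ∀ i j, B (w' i) (w' j) = 0)
    (hww' : ∀ i j, B (w i) (w' j) = if i = j then 1 else 0) :
    ∃ g : E ≃ₗ[F] E, (∀ x y, B (g x) (g y) = B x y) ∧
      (∀ i, g (v i) = w i) ∧ ∀ i, g (v' i) = w' i := by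
  cases nonempty_fintype ι
  have hv'v : ∀ i j, B (v' i) (v j) = if i = j then 1 else 0 := fun i j => by
    rw [hB, hvv']; simp [eq_comm]
  have hw'w : ∀ i j, B (w' i) (w j) = if i = j then 1 else 0 := fun i j => by
    rw [hB, hww']; simp [eq_comm]
  obtain ⟨g, hg, hgs⟩ := exists_isometry_of_orthogonal h2 B hB
    (Sum.elim (fun i => v i + v' i) fun i => v i - v' i)
    (Sum.elim (fun i => w i + w' i) fun i => w i - w' i)
    (by
      rintro (i | i) (j | j) hij <;> simp [hv, hv', hvv', hv'v] at hij ⊢ <;> simp [hij])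
    (by
      rintro (i | i) (j | j) hij <;> simp [hw, hw', hww', hw'w] at hij ⊢ <;> simp [hij])
    (by
      rintro (i | i) <;> simp [hv, hv', hvv', hv'v, hw, hw', hww', hw'w])
    (by
      rintro (i | i)
      · simpa [hv, hv', hvv', hv'v, one_add_one_eq_two] using h2
      · have h3 : (-1 - 1 : F) ≠ 0 := fun h => h2 (by linear_combination -h)
        simpa [hv, hv', hvv', hv'v] using h3)
    Finset.univ
  have hadd : ∀ i, g (v i) + g (v' i) = w i + w' i := fun i => by
    simpa using hgs (Sum.inl i) (Finset.mem_univ _)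
  have hsub : ∀ i, g (v i) - g (v' i) = w i - w' i := fun i => by
    simpa using hgs (Sum.inr i) (Finset.mem_univ _)
  have hl : ∀ i, g (v i) = w i := fun i => by
    have h : (2 : F) • g (v i) = (2 : F) • w i := by
      rw [two_smul, two_smul]
      calc g (v i) + g (v i) = (g (v i) + g (v' i)) + (g (v i) - g (v' i)) := by abel
        _ = w i + w i := by rw [hadd, hsub]; abel
    exact smul_right_injective E h2 h
  exact ⟨g, hg, hl, fun i => by simpa [hl] using hadd i⟩

/-- `bform` as a bundled bilinear form. -/
def bformBilin (F : Type*) [Field F] (N : ℕ) : LinearMap.BilinForm F (Fin N → F) :=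
  LinearMap.mk₂ F (bform F N)
    (fun _ _ _ => by simp [bform, add_mul, Finset.sum_add_distrib])
    (fun _ _ _ => by simp [bform, mul_assoc, Finset.mul_sum])
    (fun _ _ _ => by simp [bform, mul_add, Finset.sum_add_distrib])
    (fun _ _ _ => by simp [bform, mul_left_comm, Finset.mul_sum])

@[simp]
theorem bformBilin_apply (F : Type*) [Field F] (N : ℕ) (u v : Fin N → F) :
    bformBilin F N u v = bform F N u v := rfl

theorem bform_comm (F : Type*) [Field F] (N : ℕ) (u v : Fin N → F) :
    bform F N u v = bform F N v u := by
  unfold bform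
  rw [← Equiv.sum_comp Fin.revPerm]
  simp [mul_comm]

theorem bform_single_single (F : Type*) [Field F] (N : ℕ) (i j : Fin N) :
    bform F N (Pi.single i 1) (Pi.single j 1) = if i.rev = j then 1 else 0 := by
  unfold bform
  rw [Finset.sum_eq_single i (fun k _ hk => by simp [hk]) (by simp)]
  simp [Pi.single_apply]

/-- Isotropic subspaces in perfect duality have bases which are dual to each other. -/
theorem exists_dual_bases {F : Type*} [Field F] {N l : ℕ} {V V' : Submodule F (Fin N → F)}
    (hdV : finrank F V = l) (hdV' : finrank F V' = l) (hnd : V' ⊓ orthCompl F N V = ⊥) :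
    ∃ (v : Basis (Fin l) F V) (v' : Basis (Fin l) F V'),
      ∀ i j, bform F N (v i) (v' j) = if i = j then 1 else 0 := by
  let v : Basis (Fin l) F V := finBasisOfFinrankEq F V hdV
  let p : V' →ₗ[F] Dual F V := (bformBilin F N).domRestrict₁₂ V' V
  have hp : Function.Injective p := by
    rw [← LinearMap.ker_eq_bot, LinearMap.ker_eq_bot']
    intro x hx
    have hmem : (x : Fin N → F) ∈ V' ⊓ orthCompl F N V :=
      ⟨x.2, fun s hs => LinearMap.congr_fun hx (⟨s, hs⟩ : V)⟩
    rw [hnd, Submodule.mem_bot] at hmem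
    exact Subtype.ext hmem
  let e : V' ≃ₗ[F] Dual F V :=
    LinearEquiv.ofInjectiveOfFinrankEq p hp (by rw [Subspace.dual_finrank_eq, hdV, hdV'])
  refine ⟨v, v.dualBasis.map e.symm, fun i j => ?_⟩
  have h : p (e.symm (v.dualBasis j)) = v.dualBasis j := e.apply_symm_apply _
  rw [bform_comm, Basis.map_apply]
  refine (LinearMap.congr_fun h (v i)).trans ?_
  rw [Basis.dualBasis_apply_self]

theorem map_eq_span_range_of_basis {F E ι : Type*} [Field F] [AddCommGroup E] [Module F E]
    {V : Submodule F E} (v : Basis ι F V) (g : E →ₗ[F] E) (w : ι → E)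
    (h : ∀ i, g (v i) = w i) : V.map g = Submodule.span F (Set.range w) := by
  have hV : V = Submodule.span F (Set.range fun i => (v i : E)) := by
    have := congrArg (Submodule.map V.subtype) v.span_eq
    rw [Submodule.map_span, Submodule.map_top, Submodule.range_subtype, ← Set.range_comp] at this
    exact this.symm
  rw [hV, Submodule.map_span, ← Set.range_comp]
  congr 2
  exact funext h

/-- Corollary 3.4: if `(V, V')` is a nondegenerate pair of isotropic
subspaces of `F^{2n+1}` with `dim V = dim V' = ℓ`, then there is a `g ∈ O_{2n+1}(F)`
with `gV = span(e_1, …, e_ℓ)` and `gV' = span(e_{2n+2-ℓ}, …, e_{2n+1})`. -/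
theorem statement14 (F : Type*) [Field F] (hchar : (2 : F) ≠ 0)
    (n : ℕ) (hn : 1 ≤ n) (l : ℕ)
    (V V' : Submodule F (Fin (2*n+1) → F))
    (hViso : IsIsotropic F (2*n+1) V) (hV'iso : IsIsotropic F (2*n+1) V')
    (hdV : finrank F V = l) (hdV' : finrank F V' = l)
    (hnd1 : V ⊓ orthCompl F (2*n+1) V' = ⊥)
    (hnd2 : V' ⊓ orthCompl F (2*n+1) V = ⊥) :
    ∃ g : (Fin (2*n+1) → F) ≃ₗ[F] (Fin (2*n+1) → F), IsOrthMap F (2*n+1) g ∧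
      Submodule.map g.toLinearMap V =
        Submodule.span F {v : Fin (2*n+1) → F |
          ∃ i : Fin (2*n+1), (i : ℕ) < l ∧ v = Pi.single i 1} ∧
      Submodule.map g.toLinearMap V' =
        Submodule.span F {v : Fin (2*n+1) → F |
          ∃ i : Fin (2*n+1), 2*n+1-l ≤ (i : ℕ) ∧ v = Pi.single i 1} := by
  obtain ⟨v, v', hvv'⟩ := exists_dual_bases hdV hdV' hnd2
  have hdisj : V ⊓ V' = ⊥ := by
    rw [eq_bot_iff, ← hnd1]
    exact fun x hx => ⟨hx.1, fun s hs => hV'iso x hx.2 s hs⟩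
  have hl : l + l ≤ 2 * n + 1 := by
    have h := Submodule.finrank_sup_add_finrank_inf_eq V V'
    rw [hdisj, finrank_bot, add_zero, hdV, hdV'] at h
    rw [← h]
    exact (Submodule.finrank_le _).trans (by simp)
  have hlN : l ≤ 2 * n + 1 := by omega
  let c : Fin l → Fin (2 * n + 1) := Fin.castLE hlN
  obtain ⟨g, hg, hgv, hgv'⟩ := exists_isometry_of_hyperbolic hchar (bformBilin F (2 * n + 1))
    (bform_comm F _) (fun i => (v i : Fin (2 * n + 1) → F)) (fun i => v' i)
    (fun i => Pi.single (c i) 1) (fun i => Pi.single (c i).rev 1)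
    (fun i j => hViso _ (v i).2 _ (v j).2) (fun i j => hV'iso _ (v' i).2 _ (v' j).2) hvv'
    (fun i j => by
      rw [bformBilin_apply, bform_single_single, if_neg]
      simp only [c, Fin.ext_iff, Fin.val_rev, Fin.val_castLE]
      omega)
    (fun i j => by
      rw [bformBilin_apply, bform_single_single, if_neg]
      simp only [c, Fin.ext_iff, Fin.val_rev, Fin.val_castLE]
      omega)
    (fun i j => by
      rw [bformBilin_apply, bform_single_single]
      simp [c])
  refine ⟨g, hg, ?_, ?_⟩
  · rw [map_eq_span_range_of_basis v g.toLinearMap _ hgv]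
    congr 1
    ext x
    constructor
    · rintro ⟨i, rfl⟩
      exact ⟨c i, i.2, rfl⟩
    · rintro ⟨i, hi, rfl⟩
      exact ⟨⟨i, hi⟩, rfl⟩
  · rw [map_eq_span_range_of_basis v' g.toLinearMap _ hgv']
    congr 1
    ext x
    constructor
    · rintro ⟨i, rfl⟩
      refine ⟨(c i).rev, ?_, rfl⟩
      simp only [c, Fin.val_rev, Fin.val_castLE]
      omega
    · rintro ⟨i, hi, rfl⟩
      have hil : (i.rev : ℕ) < l := by
        rw [Fin.val_rev]
        omega
      refine ⟨⟨i.rev, hil⟩, ?_⟩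
      have hc : (c ⟨i.rev, hil⟩).rev = i := Fin.rev_rev i
      simp only [hc]
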